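/- Let L ≥ 1, t ≥ 1, let s_0, ..., s_t be a history of states over L boolean variables, let p < t be the index of the parent node and t the index of the child node, and let e = H(s_p, s_t). Suppose there exists a variable i* ∈ Fin L with N_{t−1}^{i*}(s_t) = 0, i.e. the minimum empirical count of the child state over s_0, ..., s_{t−1} is zero. Then α(t) ≥ α(p) − ((t−1)/t)·(e − 2)/L. -/

import Mathlib

/-- Hamming distance between two states over `L` boolean variables. -/
def hammingD {L : ℕ} (s s' : Fin L → Bool) : ℕ :=
  (Finset.univ.filter (fun i : Fin L => s i ≠ s' i)).card

/-- Average normalized Hamming distance of the node at index `m` to the rest of the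
history `s_0, ..., s_t`:  `α(m) = (1/t) · Σ_{j ≠ m} δ(s_m, s_j)`. -/
noncomputable def alphaAvg {L t : ℕ} (hist : Fin (t + 1) → Fin L → Bool)
    (m : Fin (t + 1)) : ℝ :=
  (1 / (t : ℝ)) * ∑ j ∈ Finset.univ.erase m, (hammingD (hist m) (hist j) : ℝ) / L

theorem hammingD_comm {L : ℕ} (a b : Fin L → Bool) : hammingD a b = hammingD b a := by
  simp only [hammingD, ne_comm]

/-- If `c` differs from both `a` and `b` in some variable, the triangle inequality through `c`
has slack at least `2`. -/
theorem hammingD_add_two_le {L : ℕ} {a b c : Fin L → Bool} {i : Fin L}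
    (ha : a i ≠ c i) (hb : b i ≠ c i) :
    hammingD a b + 2 ≤ hammingD c b + hammingD a c := by
  have hab : a i = b i := by
    revert ha hb
    cases a i <;> cases b i <;> cases c i <;> simp
  simp only [hammingD, Finset.card_filter]
  rw [← Finset.add_sum_erase _ _ (Finset.mem_univ i),
    ← Finset.add_sum_erase _ (fun k => if c k ≠ b k then 1 else 0) (Finset.mem_univ i),
    ← Finset.add_sum_erase _ (fun k => if a k ≠ c k then 1 else 0) (Finset.mem_univ i)]
  have h : ∑ k ∈ Finset.univ.erase i, (if a k ≠ b k then 1 else 0) ≤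
      ∑ k ∈ Finset.univ.erase i, (if c k ≠ b k then 1 else 0) +
        ∑ k ∈ Finset.univ.erase i, (if a k ≠ c k then 1 else 0) := by
    rw [← Finset.sum_add_distrib]
    refine Finset.sum_le_sum fun k _ => ?_
    cases a k <;> cases b k <;> cases c k <;> simp
  simp only [hab, ne_eq, not_true_eq_false, if_false, hb, hb.symm, not_false_eq_true,
    if_true] at h ⊢
  omega

/-- Parent-child lower bound when the minimum empirical count is zero: if the child is
the last node `s_t`, the parent is `s_p` with `p < t`, `e = H(s_p, s_t)`, and there is a
variable `i*` whose count `N_{t−1}^{i*}(s_t)` over the history `s_0, ..., s_{t−1}` is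
zero, then `α(t) ≥ α(p) − ((t−1)/t)·(e − 2)/L`. -/
theorem parent_child_alpha_lower_bound_novel {L t : ℕ} (hL : 1 ≤ L) (ht : 1 ≤ t)
    (hist : Fin (t + 1) → Fin L → Bool) (p : Fin (t + 1)) (hp : (p : ℕ) < t)
    (hnovel : ∃ i : Fin L,
      (Finset.univ.filter (fun j : Fin t =>
        hist (Fin.castSucc j) i = hist (Fin.last t) i)).card = 0) :
    alphaAvg hist (Fin.last t) ≥
      alphaAvg hist p - (((t : ℝ) - 1) / t) *
        (((hammingD (hist p) (hist (Fin.last t))) : ℝ) - 2) / L := by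
  obtain ⟨i, hi⟩ := hnovel
  have hne : ∀ j : Fin (t + 1), j ≠ Fin.last t → hist j i ≠ hist (Fin.last t) i := by
    intro j hj
    obtain ⟨k, rfl⟩ := Fin.exists_castSucc_eq.mpr hj
    exact Finset.filter_eq_empty_iff.mp (Finset.card_eq_zero.mp hi) (Finset.mem_univ k)
  have hpl : p ≠ Fin.last t := by
    rintro rfl
    simp at hp
  set e := hammingD (hist p) (hist (Fin.last t)) with he
  set S := (Finset.univ.erase p).erase (Fin.last t) with hS
  have hcard : (S.card : ℝ) = (t : ℝ) - 1 := by
    have h : S.card + 1 = t := by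
      rw [hS, Finset.card_erase_of_mem (by simp [hpl.symm]),
        Finset.card_erase_of_mem (Finset.mem_univ p), Finset.card_univ, Fintype.card_fin]
      omega
    have h' : (S.card : ℝ) + 1 = t := by exact_mod_cast h
    linarith
  have hsum : ∑ j ∈ S, (hammingD (hist p) (hist j) : ℝ) ≤
      ∑ j ∈ S, (hammingD (hist (Fin.last t)) (hist j) : ℝ) + ((t : ℝ) - 1) * (e - 2) := by
    rw [← hcard, ← nsmul_eq_mul, ← Finset.sum_const, ← Finset.sum_add_distrib]
    refine Finset.sum_le_sum fun j hj => ?_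
    have h := hammingD_add_two_le (hne p hpl) (hne j (Finset.ne_of_mem_erase hj))
    rw [← he] at h
    have h' : (hammingD (hist p) (hist j) : ℝ) + 2 ≤
        hammingD (hist (Fin.last t)) (hist j) + e := by exact_mod_cast h
    linarith
  have hchild : alphaAvg hist (Fin.last t) =
      (e + ∑ j ∈ S, (hammingD (hist (Fin.last t)) (hist j) : ℝ)) / (t * L) := by
    rw [alphaAvg, ← Finset.sum_div, ← Finset.add_sum_erase _ _
      (Finset.mem_erase.mpr ⟨hpl, Finset.mem_univ p⟩), Finset.erase_right_comm, ← hS,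
      hammingD_comm (hist (Fin.last t)) (hist p), ← he, div_mul_div_comm, one_mul]
  have hparent : alphaAvg hist p =
      (e + ∑ j ∈ S, (hammingD (hist p) (hist j) : ℝ)) / (t * L) := by
    rw [alphaAvg, ← Finset.sum_div, ← Finset.add_sum_erase _ _
      (Finset.mem_erase.mpr ⟨hpl.symm, Finset.mem_univ (Fin.last t)⟩), ← hS, ← he,
      div_mul_div_comm, one_mul]
  rw [hchild, hparent, div_mul_eq_mul_div, div_div, ← sub_div, ge_iff_le]
  gcongr
  linarith
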